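/- Let p : ℝ^d → ℝ be a continuously differentiable probability density with p(x) > 0 for all x, such that p and each component of ∇p are bounded and continuous. Then for every x ∈ ℝ^d, lim_{γ→0} γ·(d/dγ)∇_x log(p*g_γ)(x) = 0. -/

import Mathlib

open MeasureTheory Filter Real Topology

/-- The density of the Gaussian `N(0, γ I)` on `ℝ^d`. -/
noncomputable def gaussDensity (d : ℕ) (γ : ℝ) (x : EuclideanSpace ℝ (Fin d)) : ℝ :=
  (2 * π * γ) ^ (-(d : ℝ) / 2) * Real.exp (-‖x‖ ^ 2 / (2 * γ))

/-- Convolution `(p * g_γ)(x) = ∫ p(y) g_γ(x - y) dy` of a density with the Gaussian. -/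
noncomputable def gaussConv (d : ℕ) (p : EuclideanSpace ℝ (Fin d) → ℝ) (γ : ℝ)
    (x : EuclideanSpace ℝ (Fin d)) : ℝ :=
  ∫ y, p y * gaussDensity d γ (x - y)

/-- The kernel `γ ∂g_γ/∂γ`. -/
noncomputable def gaussDilation (d : ℕ) (γ : ℝ) (x : EuclideanSpace ℝ (Fin d)) : ℝ :=
  gaussDensity d γ x * (‖x‖ ^ 2 / (2 * γ) - d / 2)

section Gaussian

variable {d : ℕ} {γ : ℝ}

lemma continuous_gaussDensity (γ : ℝ) : Continuous (gaussDensity d γ) := by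
  unfold gaussDensity
  fun_prop

lemma continuous_gaussDilation (γ : ℝ) : Continuous (gaussDilation d γ) := by
  have := continuous_gaussDensity (d := d) γ
  unfold gaussDilation
  fun_prop

lemma gaussDensity_pos (hγ : 0 < γ) (x : EuclideanSpace ℝ (Fin d)) : 0 < gaussDensity d γ x := by
  unfold gaussDensity
  positivity

lemma integrable_exp_neg_mul_norm_sq {V : Type*} [NormedAddCommGroup V] [InnerProductSpace ℝ V]
    [FiniteDimensional ℝ V] [MeasurableSpace V] [BorelSpace V] {b : ℝ} (hb : 0 < b) :
    Integrable fun v : V => Real.exp (-b * ‖v‖ ^ 2) := by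
  by_contra h
  have h0 := GaussianFourier.integral_rexp_neg_mul_sq_norm (V := V) hb
  rw [integral_undef h] at h0
  have : 0 < (π / b) ^ (Module.finrank ℝ V / 2 : ℝ) := by positivity
  exact this.ne h0

lemma integral_gaussDensity (hγ : 0 < γ) : ∫ x, gaussDensity d γ x = 1 := by
  have h := GaussianFourier.integral_rexp_neg_mul_sq_norm (V := EuclideanSpace ℝ (Fin d))
    (b := (2 * γ)⁻¹) (by positivity)
  have hpos : 0 < 2 * π * γ := by positivity
  have he : ∀ x : EuclideanSpace ℝ (Fin d),
      gaussDensity d γ x = (2 * π * γ) ^ (-(d : ℝ) / 2) * Real.exp (-(2 * γ)⁻¹ * ‖x‖ ^ 2) := by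
    intro x
    unfold gaussDensity
    congr 2
    field_simp
  simp_rw [he]
  rw [integral_const_mul, h, finrank_euclideanSpace_fin, div_inv_eq_mul,
    show π * (2 * γ) = 2 * π * γ by ring, ← Real.rpow_add hpos,
    show -(d : ℝ) / 2 + d / 2 = 0 by ring, Real.rpow_zero]

lemma integrable_gaussDensity (hγ : 0 < γ) : Integrable (gaussDensity d γ) := by
  by_contra h
  have h0 := integral_gaussDensity (d := d) hγ
  rw [integral_undef h] at h0
  exact zero_ne_one h0

lemma mul_exp_neg_le (t : ℝ) : t * Real.exp (-t) ≤ 2 * Real.exp (-(t / 2)) := by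
  have h1 := Real.add_one_le_exp (t / 2)
  have h2 : Real.exp (t / 2) * Real.exp (-t) = Real.exp (-(t / 2)) := by
    rw [← Real.exp_add]
    congr 1
    ring
  nlinarith [Real.exp_pos (-t)]

lemma abs_gaussDilation_le (hγ : 0 < γ) (x : EuclideanSpace ℝ (Fin d)) :
    |gaussDilation d γ x| ≤
      (2 * π * γ) ^ (-(d : ℝ) / 2) * ((2 + d / 2) * Real.exp (-(4 * γ)⁻¹ * ‖x‖ ^ 2)) := by
  set t := ‖x‖ ^ 2 / (2 * γ) with ht
  have ht0 : 0 ≤ t := by positivity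
  have he : -(4 * γ)⁻¹ * ‖x‖ ^ 2 = -(t / 2) := by
    rw [ht]
    field_simp
    ring
  have hmono : Real.exp (-t) ≤ Real.exp (-(t / 2)) := Real.exp_le_exp.2 (by linarith)
  have habs : |t - d / 2| ≤ t + d / 2 := by
    rw [abs_le]
    constructor <;> linarith [Nat.cast_nonneg (α := ℝ) d]
  have hC : 0 ≤ (2 * π * γ) ^ (-(d : ℝ) / 2) := by positivity
  rw [he, gaussDilation, gaussDensity, neg_div (2 * γ) (‖x‖ ^ 2), ← ht, abs_mul,
    abs_of_nonneg (by positivity), mul_assoc]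
  refine mul_le_mul_of_nonneg_left ?_ hC
  calc Real.exp (-t) * |t - d / 2| ≤ Real.exp (-t) * (t + d / 2) := by gcongr
    _ = t * Real.exp (-t) + d / 2 * Real.exp (-t) := by ring
    _ ≤ 2 * Real.exp (-(t / 2)) + d / 2 * Real.exp (-(t / 2)) := by
        gcongr ?_ + d / 2 * ?_
        exact mul_exp_neg_le t
    _ = _ := by ring

lemma integrable_gaussDilation (hγ : 0 < γ) : Integrable (gaussDilation d γ) :=
  (((integrable_exp_neg_mul_norm_sq (inv_pos.2 (by positivity))).const_mul _).const_mul _).mono'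
    (continuous_gaussDilation γ).aestronglyMeasurable
    (ae_of_all _ fun x => abs_gaussDilation_le hγ x)

lemma hasDerivAt_gaussDensity (hγ : 0 < γ) (x : EuclideanSpace ℝ (Fin d)) :
    HasDerivAt (fun s => gaussDensity d s x) (γ⁻¹ * gaussDilation d γ x) γ := by
  have hpos : 0 < 2 * π * γ := by positivity
  have h1 : HasDerivAt (fun s : ℝ => (2 * π * s) ^ (-(d : ℝ) / 2))
      (2 * π * (-(d : ℝ) / 2) * (2 * π * γ) ^ (-(d : ℝ) / 2 - 1)) γ := by
    simpa using ((hasDerivAt_id γ).const_mul (2 * π)).rpow_const (p := -(d : ℝ) / 2)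
      (Or.inl hpos.ne')
  have h2 : HasDerivAt (fun s : ℝ => Real.exp (-‖x‖ ^ 2 / (2 * s)))
      (Real.exp (-‖x‖ ^ 2 / (2 * γ)) * (‖x‖ ^ 2 / (2 * γ ^ 2))) γ := by
    refine HasDerivAt.exp ?_
    convert! (hasDerivAt_const γ (-‖x‖ ^ 2)).div ((hasDerivAt_id γ).const_mul 2)
      (by simpa using hγ.ne') using 1
    simp
    field_simp
  convert! h1.mul h2 using 1
  rw [Real.rpow_sub_one hpos.ne', gaussDilation, gaussDensity]
  field_simp
  ring

lemma gaussDensity_sqrt_smul (hγ : 0 < γ) (x : EuclideanSpace ℝ (Fin d)) :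
    gaussDensity d γ (√γ • x) = (√γ ^ d)⁻¹ * gaussDensity d 1 x := by
  have hs : √γ ^ 2 = γ := Real.sq_sqrt hγ.le
  have hpow : γ ^ (-(d : ℝ) / 2) = (√γ ^ d)⁻¹ := by
    rw [neg_div, Real.rpow_neg hγ.le, Real.sqrt_eq_rpow, ← Real.rpow_natCast, ← Real.rpow_mul hγ.le]
    congr 2
    ring
  unfold gaussDensity
  rw [Real.mul_rpow (by positivity) hγ.le, hpow, norm_smul, Real.norm_eq_abs, mul_pow, sq_abs, hs,
    show -(γ * ‖x‖ ^ 2) / (2 * γ) = -‖x‖ ^ 2 / (2 * 1) by field_simp]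
  ring_nf

lemma gaussDilation_sqrt_smul (hγ : 0 < γ) (x : EuclideanSpace ℝ (Fin d)) :
    gaussDilation d γ (√γ • x) = (√γ ^ d)⁻¹ * gaussDilation d 1 x := by
  have hs : √γ ^ 2 = γ := Real.sq_sqrt hγ.le
  unfold gaussDilation
  rw [gaussDensity_sqrt_smul hγ, norm_smul, Real.norm_eq_abs, mul_pow, sq_abs, hs,
    show γ * ‖x‖ ^ 2 / (2 * γ) = ‖x‖ ^ 2 / (2 * 1) by field_simp]
  ring

end Gaussian

section Convolution

variable {d : ℕ} {F : Type*} [NormedAddCommGroup F] [NormedSpace ℝ F]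
  {h : EuclideanSpace ℝ (Fin d) → F} {C : ℝ}

lemma integrable_smul_comp_sub {k : EuclideanSpace ℝ (Fin d) → ℝ} (hk : Integrable k)
    (hh : Continuous h) (hC : ∀ x, ‖h x‖ ≤ C) (x : EuclideanSpace ℝ (Fin d)) :
    Integrable fun w => k w • h (x - w) := by
  refine (hk.norm.mul_const C).mono' (hk.aestronglyMeasurable.smul
    (by fun_prop : Continuous fun w => h (x - w)).aestronglyMeasurable) (ae_of_all _ fun w => ?_)
  rw [norm_smul]
  gcongr
  exact hC _

/-- A family of kernels obtained from `κ 1` by parabolic rescaling, integrated against a bounded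
continuous function, concentrates at a point as the scale tends to `0`. -/
lemma tendsto_integral_rescaled_kernel {κ : ℝ → EuclideanSpace ℝ (Fin d) → ℝ}
    (hκ : Integrable (κ 1))
    (hscale : ∀ γ, 0 < γ → ∀ x, κ γ (√γ • x) = (√γ ^ d)⁻¹ * κ 1 x)
    [CompleteSpace F] (hh : Continuous h) (hC : ∀ x, ‖h x‖ ≤ C) (x : EuclideanSpace ℝ (Fin d)) :
    Tendsto (fun γ : ℝ => ∫ w, κ γ w • h (x - w)) (𝓝[>] 0) (𝓝 ((∫ w, κ 1 w) • h x)) := by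
  have hlim : Tendsto (fun γ : ℝ => ∫ u, κ 1 u • h (x - √γ • u)) (𝓝[>] 0)
      (𝓝 (∫ u, κ 1 u • h x)) := by
    refine tendsto_integral_filter_of_dominated_convergence (fun u => ‖κ 1 u‖ * C) ?_ ?_
      (hκ.norm.mul_const C) (ae_of_all _ fun u => ?_)
    · exact Eventually.of_forall fun γ => hκ.aestronglyMeasurable.smul
        (by fun_prop : Continuous fun u => h (x - √γ • u)).aestronglyMeasurable
    · refine Eventually.of_forall fun γ => ae_of_all _ fun u => ?_
      rw [norm_smul]
      gcongr
      exact hC _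
    · have hc : Continuous fun γ : ℝ => κ 1 u • h (x - √γ • u) := by fun_prop
      simpa using (hc.tendsto 0).mono_left nhdsWithin_le_nhds
  rw [← integral_smul_const]
  refine hlim.congr' ?_
  filter_upwards [self_mem_nhdsWithin] with γ hγ
  have hγ : 0 < γ := hγ
  have hs : 0 < √γ := Real.sqrt_pos.2 hγ
  have := Measure.integral_comp_smul_of_nonneg volume (fun w => κ γ w • h (x - w)) (√γ)
    (hR := hs.le)
  simp_rw [hscale γ hγ, mul_smul, integral_smul, finrank_euclideanSpace_fin] at this
  exact smul_right_injective F (inv_ne_zero (pow_pos hs d).ne') this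

lemma hasDerivAt_integral_gaussDensity_smul (hh : Continuous h) (hC : ∀ x, ‖h x‖ ≤ C)
    (x : EuclideanSpace ℝ (Fin d)) {γ : ℝ} (hγ : 0 < γ) :
    HasDerivAt (fun s : ℝ => ∫ w, gaussDensity d s w • h (x - w))
      (γ⁻¹ • ∫ w, gaussDilation d γ w • h (x - w)) γ := by
  rw [← integral_smul]
  simp_rw [smul_smul]
  have hC0 : 0 ≤ C := (norm_nonneg _).trans (hC 0)
  have hcont : Continuous fun w => h (x - w) := by fun_prop
  refine (hasDerivAt_integral_of_dominated_loc_of_deriv_le (s := Set.Ioo (γ / 2) (2 * γ))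
    (F' := fun s w => (s⁻¹ * gaussDilation d s w) • h (x - w))
    (bound := fun w => (γ / 2)⁻¹ * ((π * γ) ^ (-(d : ℝ) / 2) *
      ((2 + d / 2) * Real.exp (-(8 * γ)⁻¹ * ‖w‖ ^ 2))) * C)
    (Ioo_mem_nhds (by linarith) (by linarith)) ?_ ?_ ?_ ?_ ?_ ?_).2
  · exact Eventually.of_forall fun s =>
      ((continuous_gaussDensity s).smul hcont).aestronglyMeasurable
  · exact integrable_smul_comp_sub (integrable_gaussDensity hγ) hh hC x
  · exact (((continuous_gaussDilation γ).const_mul _).smul hcont).aestronglyMeasurable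
  · refine ae_of_all _ fun w s hs => ?_
    have hs0 : 0 < s := by linarith [hs.1]
    rw [norm_smul, norm_mul, Real.norm_eq_abs, Real.norm_eq_abs, abs_of_pos (inv_pos.2 hs0)]
    have hpow : (2 * π * s) ^ (-(d : ℝ) / 2) ≤ (π * γ) ^ (-(d : ℝ) / 2) :=
      Real.rpow_le_rpow_of_nonpos (by positivity) (by nlinarith [hs.1, Real.pi_pos])
        (by linarith [Nat.cast_nonneg (α := ℝ) d])
    have hexp : -(4 * s)⁻¹ ≤ -(8 * γ)⁻¹ :=
      neg_le_neg (inv_anti₀ (by positivity) (by linarith [hs.2]))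
    gcongr
    · exact hs.1.le
    · refine (abs_gaussDilation_le hs0 w).trans ?_
      gcongr
    · exact hC _
  · exact (((((integrable_exp_neg_mul_norm_sq (inv_pos.2 (by positivity))).const_mul
      _).const_mul _).const_mul _).mul_const _)
  · refine ae_of_all _ fun w s hs => ?_
    exact (hasDerivAt_gaussDensity (by linarith [hs.1]) w).smul_const _

lemma integral_gaussDilation {γ : ℝ} (hγ : 0 < γ) : ∫ w, gaussDilation d γ w = 0 := by
  have h1 := hasDerivAt_integral_gaussDensity_smul (d := d) (h := fun _ => (1 : ℝ)) (C := 1)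
    continuous_const (by simp) 0 hγ
  have h2 : HasDerivAt (fun s : ℝ => ∫ w, gaussDensity d s w • (1 : ℝ)) 0 γ := by
    refine (hasDerivAt_const γ (1 : ℝ)).congr_of_eventuallyEq ?_
    filter_upwards [lt_mem_nhds hγ] with s hs
    simpa using integral_gaussDensity hs
  simpa [hγ.ne'] using h1.unique h2

lemma tendsto_integral_gaussDensity_smul [CompleteSpace F] (hh : Continuous h)
    (hC : ∀ x, ‖h x‖ ≤ C) (x : EuclideanSpace ℝ (Fin d)) :
    Tendsto (fun γ : ℝ => ∫ w, gaussDensity d γ w • h (x - w)) (𝓝[>] 0) (𝓝 (h x)) := by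
  simpa [integral_gaussDensity one_pos] using tendsto_integral_rescaled_kernel
    (integrable_gaussDensity one_pos) (fun γ hγ => gaussDensity_sqrt_smul hγ) hh hC x

lemma tendsto_integral_gaussDilation_smul [CompleteSpace F] (hh : Continuous h)
    (hC : ∀ x, ‖h x‖ ≤ C) (x : EuclideanSpace ℝ (Fin d)) :
    Tendsto (fun γ : ℝ => ∫ w, gaussDilation d γ w • h (x - w)) (𝓝[>] 0) (𝓝 0) := by
  simpa [integral_gaussDilation one_pos] using tendsto_integral_rescaled_kernel
    (integrable_gaussDilation one_pos) (fun γ hγ => gaussDilation_sqrt_smul hγ) hh hC x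

lemma gaussConv_eq_integral_smul (p : EuclideanSpace ℝ (Fin d) → ℝ) (γ : ℝ)
    (x : EuclideanSpace ℝ (Fin d)) :
    gaussConv d p γ x = ∫ w, gaussDensity d γ w • p (x - w) := by
  rw [gaussConv, ← integral_sub_left_eq_self _ volume x]
  simp [mul_comm]

end Convolution

section Score

variable {d : ℕ} {p : EuclideanSpace ℝ (Fin d) → ℝ} {C C' : ℝ} {γ : ℝ}

lemma gaussConv_pos (hpos : ∀ x, 0 < p x) (hp : Continuous p) (hC : ∀ x, |p x| ≤ C)
    (hγ : 0 < γ) (x : EuclideanSpace ℝ (Fin d)) : 0 < gaussConv d p γ x := by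
  have hw : ∀ w, 0 < gaussDensity d γ w • p (x - w) := fun w =>
    mul_pos (gaussDensity_pos hγ w) (hpos _)
  rw [gaussConv_eq_integral_smul, integral_pos_iff_support_of_nonneg (fun w => (hw w).le)
    (integrable_smul_comp_sub (integrable_gaussDensity hγ) hp hC x),
    Set.eq_univ_of_forall (s := Function.support _) fun w => (hw w).ne']
  exact NeZero.pos _

lemma hasGradientAt_gaussConv (hp : ContDiff ℝ 1 p) (hC : ∀ x, |p x| ≤ C)
    (hg : Continuous (gradient p)) (hC' : ∀ x, ‖gradient p x‖ ≤ C') (hγ : 0 < γ)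
    (x : EuclideanSpace ℝ (Fin d)) :
    HasGradientAt (gaussConv d p γ) (∫ w, gaussDensity d γ w • gradient p (x - w)) x := by
  have hcont : Continuous p := hp.continuous
  rw [hasGradientAt_iff_hasFDerivAt, ← LinearIsometryEquiv.coe_toContinuousLinearEquiv,
    ← ContinuousLinearEquiv.integral_comp_comm]
  rw [funext (gaussConv_eq_integral_smul p γ)]
  refine hasFDerivAt_integral_of_dominated_of_fderiv_le (s := Set.univ)
    (F' := fun y w => InnerProductSpace.toDual ℝ _ (gaussDensity d γ w • gradient p (y - w)))
    (bound := fun w => gaussDensity d γ w * C') univ_mem ?_ ?_ ?_ ?_ ?_ ?_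
  · have := continuous_gaussDensity (d := d) γ
    exact Eventually.of_forall fun y =>
      (by fun_prop : Continuous fun w => gaussDensity d γ w • p (y - w)).aestronglyMeasurable
  · exact integrable_smul_comp_sub (integrable_gaussDensity hγ) hcont hC x
  · have := continuous_gaussDensity (d := d) γ
    exact ((InnerProductSpace.toDual ℝ _).continuous.comp
      (by fun_prop : Continuous fun w =>
        gaussDensity d γ w • gradient p (x - w))).aestronglyMeasurable
  · refine ae_of_all _ fun w y _ => ?_
    rw [LinearIsometryEquiv.norm_map, norm_smul, Real.norm_eq_abs,
      abs_of_pos (gaussDensity_pos hγ w)]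
    exact mul_le_mul_of_nonneg_left (hC' _) (gaussDensity_pos hγ w).le
  · exact (integrable_gaussDensity hγ).mul_const C'
  · refine ae_of_all _ fun w y _ => ?_
    have h1 := ((hp.differentiable one_ne_zero (y - w)).hasGradientAt.hasFDerivAt.comp y
      ((hasFDerivAt_id y).sub_const w)).const_smul (gaussDensity d γ w)
    convert! h1 using 1
    simp

lemma gradient_log_gaussConv (hp : ContDiff ℝ 1 p) (hpos : ∀ x, 0 < p x) (hC : ∀ x, |p x| ≤ C)
    (hg : Continuous (gradient p)) (hC' : ∀ x, ‖gradient p x‖ ≤ C') (hγ : 0 < γ)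
    (x : EuclideanSpace ℝ (Fin d)) :
    gradient (fun y => Real.log (gaussConv d p γ y)) x =
      (gaussConv d p γ x)⁻¹ • ∫ w, gaussDensity d γ w • gradient p (x - w) := by
  have h := (hasGradientAt_gaussConv hp hC hg hC' hγ x).hasFDerivAt.log
    (gaussConv_pos hpos hp.continuous hC hγ x).ne'
  refine HasGradientAt.gradient (hasGradientAt_iff_hasFDerivAt.2 ?_)
  simpa using h

end Score

/-- For a continuously differentiable, everywhere positive probability density `p` with `p` and
`∇p` bounded (and continuous), `lim_{γ→0⁺} γ·(d/dγ)∇ₓ log(p*g_γ)(x) = 0`. -/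
theorem gamma_deriv_score_tendsto_zero (d : ℕ) (p : EuclideanSpace ℝ (Fin d) → ℝ)
    (hsmooth : ContDiff ℝ 1 p) (hpos : ∀ x, 0 < p x) (hprob : ∫ x, p x = 1)
    (hpcont : Continuous p) (hpbdd : ∃ C, ∀ x, |p x| ≤ C)
    (hgradcont : Continuous (gradient p)) (hgradbdd : ∃ C, ∀ x, ‖gradient p x‖ ≤ C)
    (x : EuclideanSpace ℝ (Fin d)) :
    Tendsto (fun γ : ℝ =>
        γ • deriv (fun s : ℝ => gradient (fun y => Real.log (gaussConv d p s y)) x) γ)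
      (𝓝[>] (0 : ℝ)) (𝓝 (0 : EuclideanSpace ℝ (Fin d))) := by
  obtain ⟨C, hC⟩ := hpbdd
  obtain ⟨C', hC'⟩ := hgradbdd
  set q : ℝ → ℝ := fun γ => ∫ w, gaussDensity d γ w • p (x - w)
  set G : ℝ → EuclideanSpace ℝ (Fin d) := fun γ => ∫ w, gaussDensity d γ w • gradient p (x - w)
  set q' : ℝ → ℝ := fun γ => ∫ w, gaussDilation d γ w • p (x - w)
  set G' : ℝ → EuclideanSpace ℝ (Fin d) := fun γ => ∫ w, gaussDilation d γ w • gradient p (x - w)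
  have hderiv : ∀ γ, 0 < γ →
      γ • deriv (fun s : ℝ => gradient (fun y => Real.log (gaussConv d p s y)) x) γ =
        (q γ)⁻¹ • G' γ + (-q' γ / q γ ^ 2) • G γ := by
    intro γ hγ
    have hqpos : 0 < q γ := by
      simpa only [gaussConv_eq_integral_smul] using gaussConv_pos hpos hpcont hC hγ x
    have hqd : HasDerivAt q (γ⁻¹ • q' γ) γ := hasDerivAt_integral_gaussDensity_smul hpcont hC x hγ
    have hGd : HasDerivAt G (γ⁻¹ • G' γ) γ :=
      hasDerivAt_integral_gaussDensity_smul hgradcont hC' x hγ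
    have hscore : (fun s : ℝ => gradient (fun y => Real.log (gaussConv d p s y)) x) =ᶠ[𝓝 γ]
        fun s => (q s)⁻¹ • G s := by
      filter_upwards [lt_mem_nhds hγ] with s hs
      rw [gradient_log_gaussConv hsmooth hpos hC hgradcont hC' hs, gaussConv_eq_integral_smul]
    rw [hscore.deriv_eq, ((hqd.fun_inv hqpos.ne').fun_smul hGd).deriv, smul_add, smul_smul,
      smul_smul, smul_smul]
    congr 2
    · field_simp
    · rw [smul_eq_mul]
      field_simp
  have hlim : Tendsto (fun γ => (q γ)⁻¹ • G' γ + (-q' γ / q γ ^ 2) • G γ) (𝓝[>] 0)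
      (𝓝 ((p x)⁻¹ • (0 : EuclideanSpace ℝ (Fin d)) + (-0 / p x ^ 2) • gradient p x)) := by
    have hqt : Tendsto q (𝓝[>] 0) (𝓝 (p x)) := tendsto_integral_gaussDensity_smul hpcont hC x
    exact ((hqt.inv₀ (hpos x).ne').smul
      (tendsto_integral_gaussDilation_smul hgradcont hC' x)).add
      (((tendsto_integral_gaussDilation_smul hpcont hC x).neg.div (hqt.pow 2)
        (pow_ne_zero 2 (hpos x).ne')).smul
      (tendsto_integral_gaussDensity_smul hgradcont hC' x))
  simp only [neg_zero, zero_div, zero_smul, smul_zero, add_zero] at hlim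
  refine hlim.congr' ?_
  filter_upwards [self_mem_nhdsWithin] with γ hγ
  exact (hderiv γ hγ).symm
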